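/- Discrete biorthogonality of the Pastro polynomials on the real line: let N be a positive integer, set a = q^{1-N}, and let x_s = q^{s+1} for s = 0, 1, ..., N-1. Then for all m, n ∈ {0, 1, ..., N-1}: Σ_{s=0}^{N-1} w_s P_n(x_s) R_m(x_s) = h_n δ_{mn}, where w_s = [1/(b;q)_{N-1}] · [(q^{1-N};q)_s / (q;q)_s] · (b q^{N-1})^s and h_n = (a;q)_n (q;q)_n / ( (a b^{-1} q;q)_n (b;q)_n ). -/

import Mathlib

/-- The q-Pochhammer symbol `(z;q)_k = ∏_{j=0}^{k-1} (1 - z q^j)`. -/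
noncomputable def qPoch (q z : ℝ) (k : ℕ) : ℝ :=
  ∏ j ∈ Finset.range k, (1 - z * q ^ j)

/-- Coefficient `c_{n,k}` of the monic Pastro polynomial. -/
noncomputable def pastroCoeff (q a b : ℝ) (n k : ℕ) : ℝ :=
  (qPoch q (a⁻¹ * b * q ^ (1 - (n : ℤ))) n * qPoch q q n /
      (qPoch q (q ^ (-(n : ℤ))) n * qPoch q b n)) *
    (qPoch q (q ^ (-(n : ℤ))) k * qPoch q b k /
      (qPoch q (a⁻¹ * b * q ^ (1 - (n : ℤ))) k * qPoch q q k))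

/-- The monic Pastro polynomial `P_n(x;a,b;q)`. -/
noncomputable def pastroP (q a b : ℝ) (n : ℕ) (x : ℝ) : ℝ :=
  ∑ k ∈ Finset.range (n + 1), pastroCoeff q a b n k * x ^ k

/-- The biorthogonal partner `R_n(x;a,b;q)` of the Pastro polynomials. -/
noncomputable def pastroR (q a b : ℝ) (n : ℕ) (x : ℝ) : ℝ :=
  (qPoch q (q ^ (-(n : ℤ))) n * qPoch q (b * q⁻¹) n /
      (qPoch q (a⁻¹ * b * q ^ (-(n : ℤ))) n * qPoch q q n)) *
    ∑ k ∈ Finset.range (n + 1),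
      (qPoch q (q ^ (-(n : ℤ))) k * qPoch q (a * b⁻¹ * q) k /
          (qPoch q (b⁻¹ * q ^ (2 - (n : ℤ))) k * qPoch q q k)) *
        (q ^ 2 / (a * x)) ^ k

/-- The discrete weight `w_s` of the Pastro biorthogonality on the real line. -/
noncomputable def pastroW (q b : ℝ) (N s : ℕ) : ℝ :=
  (qPoch q b (N - 1))⁻¹ * (qPoch q (q ^ (1 - (N : ℤ))) s / qPoch q q s) *
    (b * q ^ ((N : ℤ) - 1)) ^ s

section

open Finset Polynomial

section QPochhammer

variable {q : ℝ}

lemma qPoch_zero (q z : ℝ) : qPoch q z 0 = 1 := by simp [qPoch]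

lemma qPoch_succ (q z : ℝ) (k : ℕ) : qPoch q z (k + 1) = qPoch q z k * (1 - z * q ^ k) := by
  simp [qPoch, prod_range_succ]

lemma qPoch_add (q z : ℝ) (i j : ℕ) :
    qPoch q z (i + j) = qPoch q z i * qPoch q (z * q ^ i) j := by
  simp only [qPoch, prod_range_add, pow_add, mul_assoc]

lemma qPoch_succ' (q z : ℝ) (k : ℕ) : qPoch q z (k + 1) = (1 - z) * qPoch q (z * q) k := by
  rw [add_comm, qPoch_add]
  simp [qPoch]

lemma qPoch_ne_zero {z : ℝ} (hz : ∀ i : ℕ, z * q ^ i ≠ 1) (k : ℕ) : qPoch q z k ≠ 0 :=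
  prod_ne_zero_iff.2 fun i _ => sub_ne_zero.2 (hz i).symm

lemma qPoch_mul_zpow_ne_zero (hq : q ≠ 0) {b : ℝ} (hbq : ∀ m : ℤ, b * q ^ m ≠ 1) (m : ℤ)
    (k : ℕ) : qPoch q (b * q ^ m) k ≠ 0 :=
  qPoch_ne_zero (fun i => by
    rw [mul_assoc, ← zpow_natCast, ← zpow_add₀ hq]
    exact hbq _) k

lemma qPoch_base_ne_zero (hq1 : ∀ k : ℤ, k ≠ 0 → q ^ k ≠ 1) (k : ℕ) : qPoch q q k ≠ 0 :=
  qPoch_ne_zero (fun i => by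
    have := hq1 (i + 1 : ℕ) (by positivity)
    rwa [zpow_natCast, pow_succ'] at this) k

/-- Inversion of the base point: `(z;q)_n = (-z)^n q^{n(n-1)/2} (z⁻¹q^{1-n};q)_n`. -/
lemma qPoch_reverse (hq : q ≠ 0) {z : ℝ} (hz : z ≠ 0) (n : ℕ) :
    qPoch q z n = (-z) ^ n * (∏ i ∈ range n, q ^ i) * qPoch q (z⁻¹ * q ^ (1 - (n : ℤ))) n := by
  have h : qPoch q (z⁻¹ * q ^ (1 - (n : ℤ))) n = ∏ i ∈ range n, (1 - z⁻¹ * (q ^ i)⁻¹) := by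
    rw [qPoch, ← prod_range_reflect]
    refine prod_congr rfl fun i hi => ?_
    have hi' : i + 1 ≤ n := mem_range.1 hi
    rw [mul_assoc, ← zpow_natCast, ← zpow_add₀ hq, ← zpow_natCast, ← zpow_neg]
    congr 3
    omega
  rw [h, qPoch, ← card_range n, ← prod_const, card_range, ← prod_mul_distrib, ← prod_mul_distrib]
  refine prod_congr rfl fun i _ => ?_
  field_simp
  ring

lemma prod_pow_sq_mul (q : ℝ) (n : ℕ) :
    (∏ i ∈ range n, q ^ i) ^ 2 * q ^ n = (q ^ n) ^ n := by
  induction n with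
  | zero => simp
  | succ n ih =>
    rw [prod_range_succ]
    calc _ = ((∏ i ∈ range n, q ^ i) ^ 2 * q ^ n) * q ^ (2 * n + 1) := by ring
      _ = _ := by rw [ih]; ring

end QPochhammer

section QBinomial

variable {q : ℝ}

/-- The coefficients `(q^{-n};q)_k / (q;q)_k` of terminating basic hypergeometric series. -/
noncomputable def qBinomCoeff (q : ℝ) (n k : ℕ) : ℝ :=
  qPoch q (q ^ (-(n : ℤ))) k / qPoch q q k

lemma qBinomCoeff_zero_right (q : ℝ) (n : ℕ) : qBinomCoeff q n 0 = 1 := by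
  simp [qBinomCoeff, qPoch_zero]

lemma qBinomCoeff_self_succ (hq : q ≠ 0) (n : ℕ) : qBinomCoeff q n (n + 1) = 0 := by
  rw [qBinomCoeff, qPoch_succ, zpow_neg, zpow_natCast, inv_mul_cancel₀ (pow_ne_zero _ hq)]
  simp

lemma qBinomCoeff_succ_succ (hq : q ≠ 0) (hq1 : ∀ k : ℤ, k ≠ 0 → q ^ k ≠ 1) (n k : ℕ) :
    qBinomCoeff q (n + 1) (k + 1) =
      qBinomCoeff q n (k + 1) - (q ^ (n + 1))⁻¹ * qBinomCoeff q n k := by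
  have h1 : qPoch q q k ≠ 0 := qPoch_base_ne_zero hq1 k
  have h2 : 1 - q * q ^ k ≠ 0 := by
    have := qPoch_base_ne_zero hq1 (k + 1)
    rw [qPoch_succ] at this
    exact right_ne_zero_of_mul this
  have h3 : q ^ (-((n + 1 : ℕ) : ℤ)) * q = q ^ (-(n : ℤ)) := by
    rw [← zpow_add_one₀ hq]
    congr 1
    push_cast
    ring
  unfold qBinomCoeff
  rw [qPoch_succ', h3, qPoch_succ q q, qPoch_succ]
  simp only [zpow_neg, zpow_natCast]
  field_simp
  ring

lemma sum_qBinomCoeff_succ (hq : q ≠ 0) (hq1 : ∀ k : ℤ, k ≠ 0 → q ^ k ≠ 1) (n : ℕ)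
    (f : ℕ → ℝ) :
    ∑ k ∈ range (n + 2), qBinomCoeff q (n + 1) k * f k =
      ∑ k ∈ range (n + 1), qBinomCoeff q n k * f k -
        (q ^ (n + 1))⁻¹ * ∑ k ∈ range (n + 1), qBinomCoeff q n k * f (k + 1) := by
  have h : ∑ k ∈ range (n + 1), qBinomCoeff q n k * f k =
      ∑ k ∈ range (n + 2), qBinomCoeff q n k * f k := by
    rw [sum_range_succ _ (n + 1), qBinomCoeff_self_succ hq]
    simp
  rw [h, sum_range_succ', sum_range_succ' _ (n + 1), qBinomCoeff_zero_right,
    qBinomCoeff_zero_right, mul_sum, add_sub_right_comm, ← sum_sub_distrib]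
  congr 1
  refine sum_congr rfl fun k _ => ?_
  rw [qBinomCoeff_succ_succ hq hq1]
  ring

/-- The terminating q-binomial theorem. -/
lemma sum_qBinomCoeff_mul_pow (hq : q ≠ 0) (hq1 : ∀ k : ℤ, k ≠ 0 → q ^ k ≠ 1) (n : ℕ) (z : ℝ) :
    ∑ k ∈ range (n + 1), qBinomCoeff q n k * z ^ k = qPoch q (z * (q ^ n)⁻¹) n := by
  induction n with
  | zero => simp [qBinomCoeff_zero_right, qPoch_zero]
  | succ n ih =>
    have h : z * (q ^ (n + 1))⁻¹ * q = z * (q ^ n)⁻¹ := by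
      rw [pow_succ]
      field_simp
    rw [sum_qBinomCoeff_succ hq hq1, ih, qPoch_succ', h]
    simp only [pow_succ z, ← mul_assoc, ← sum_mul, ih]
    ring

/-- `(q^{-n};q)_k q^k / (q;q)_k` annihilates polynomials in `q^k` of degree less than `n`. -/
lemma sum_qBinomCoeff_mul_eval (hq : q ≠ 0) (hq1 : ∀ k : ℤ, k ≠ 0 → q ^ k ≠ 1) {n : ℕ}
    {p : ℝ[X]} (hp : p.natDegree < n) :
    ∑ k ∈ range (n + 1), qBinomCoeff q n k * (q ^ k * p.eval (q ^ k)) = 0 := by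
  simp only [eval_eq_sum_range' hp, mul_sum]
  rw [sum_comm]
  refine sum_eq_zero fun i hi => ?_
  have hi' : i < n := mem_range.1 hi
  have h : ∀ k, qBinomCoeff q n k * (q ^ k * (p.coeff i * (q ^ k) ^ i)) =
      p.coeff i * (qBinomCoeff q n k * (q ^ (i + 1)) ^ k) := fun k => by ring
  simp only [h]
  rw [← mul_sum, sum_qBinomCoeff_mul_pow hq hq1, qPoch,
    prod_eq_zero (mem_range.2 (show n - (i + 1) < n by omega)), mul_zero]
  rw [mul_right_comm, ← pow_add, show i + 1 + (n - (i + 1)) = n by omega,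
    mul_inv_cancel₀ (pow_ne_zero _ hq), sub_self]

lemma sum_qBinomCoeff_div (hq : q ≠ 0) (hq1 : ∀ k : ℤ, k ≠ 0 → q ^ k ≠ 1) (n : ℕ) {c : ℝ}
    (hc : ∀ i : ℕ, c * q ^ i ≠ 1) :
    ∑ k ∈ range (n + 1), qBinomCoeff q n k * (q ^ k / (1 - c * q ^ k)) =
      c ^ n * qPoch q q n / qPoch q c (n + 1) := by
  induction n generalizing c with
  | zero => simp [qBinomCoeff_zero_right, qPoch]
  | succ n ih =>
    have hc' : ∀ i : ℕ, c * q * q ^ i ≠ 1 := fun i => by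
      rw [mul_assoc, ← pow_succ']
      exact hc _
    have h : ∀ k, qBinomCoeff q n k * (q ^ (k + 1) / (1 - c * q ^ (k + 1))) =
        q * (qBinomCoeff q n k * (q ^ k / (1 - c * q * q ^ k))) := fun k => by
      rw [pow_succ', ← mul_assoc c]
      ring
    rw [sum_qBinomCoeff_succ hq hq1]
    simp only [h]
    rw [← mul_sum, ih hc, ih hc', qPoch_succ q c (n + 1), qPoch_succ q q]
    have h1 : qPoch q c (n + 1) = (1 - c) * qPoch q (c * q) n := qPoch_succ' q c n
    have h2 := qPoch_succ q (c * q) n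
    have h3 : qPoch q (c * q) n ≠ 0 := qPoch_ne_zero hc' n
    have h4 : 1 - c ≠ 0 := sub_ne_zero.2 (by simpa using (hc 0).symm)
    have h5 : 1 - c * q ^ (n + 1) ≠ 0 := sub_ne_zero.2 (hc (n + 1)).symm
    have h6 : c * q * q ^ n = c * q ^ (n + 1) := by ring
    rw [h1, h2, h6, mul_pow]
    field_simp
    ring

lemma sum_qBinomCoeff_mul_eval_div (hq : q ≠ 0) (hq1 : ∀ k : ℤ, k ≠ 0 → q ^ k ≠ 1) {n : ℕ}
    {p : ℝ[X]} (hp : p.natDegree ≤ n) {c : ℝ} (hc0 : c ≠ 0) (hc : ∀ i : ℕ, c * q ^ i ≠ 1) :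
    ∑ k ∈ range (n + 1), qBinomCoeff q n k * (q ^ k * (p.eval (q ^ k) / (1 - c * q ^ k))) =
      p.eval c⁻¹ * (c ^ n * qPoch q q n / qPoch q c (n + 1)) := by
  obtain ⟨r, hr⟩ := X_sub_C_dvd_sub_C_eval (a := c⁻¹) (p := p)
  have hpr : ∀ k, p.eval (q ^ k) / (1 - c * q ^ k) =
      p.eval c⁻¹ * (1 / (1 - c * q ^ k)) - c⁻¹ * r.eval (q ^ k) := fun k => by
    have h1 : 1 - c * q ^ k ≠ 0 := sub_ne_zero.2 (hc k).symm
    have h2 := congrArg (eval (q ^ k)) hr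
    simp only [eval_sub, eval_C, eval_mul, eval_X] at h2
    rw [div_eq_iff h1, sub_mul, mul_assoc, one_div_mul_cancel h1]
    linear_combination h2 - r.eval (q ^ k) * q ^ k * inv_mul_cancel₀ hc0
  have hsum : ∑ k ∈ range (n + 1), qBinomCoeff q n k * (q ^ k * r.eval (q ^ k)) = 0 := by
    rcases eq_or_ne r 0 with rfl | hr0
    · simp
    · refine sum_qBinomCoeff_mul_eval hq hq1 ?_
      have h1 := congrArg natDegree hr
      rw [natDegree_sub_C, natDegree_mul (X_sub_C_ne_zero _) hr0, natDegree_X_sub_C] at h1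
      omega
  have hterm : ∀ k, qBinomCoeff q n k * (q ^ k * (p.eval (q ^ k) / (1 - c * q ^ k))) =
      p.eval c⁻¹ * (qBinomCoeff q n k * (q ^ k / (1 - c * q ^ k))) -
        c⁻¹ * (qBinomCoeff q n k * (q ^ k * r.eval (q ^ k))) := fun k => by
    rw [hpr]
    ring
  simp only [hterm]
  rw [sum_sub_distrib, ← mul_sum, ← mul_sum, hsum, sum_qBinomCoeff_div hq hq1 n hc]
  ring

/-- The polynomial `(uX;q)_k`. -/
noncomputable def qPochPoly (q u : ℝ) (k : ℕ) : ℝ[X] :=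
  ∏ i ∈ range k, (1 - C (u * q ^ i) * X)

lemma eval_qPochPoly (q u y : ℝ) (k : ℕ) : (qPochPoly q u k).eval y = qPoch q (u * y) k := by
  simp only [qPochPoly, qPoch, eval_prod, eval_sub, eval_one, eval_mul, eval_C, eval_X]
  exact prod_congr rfl fun i _ => by ring

lemma natDegree_qPochPoly_le (q u : ℝ) (k : ℕ) : (qPochPoly q u k).natDegree ≤ k := by
  refine (natDegree_prod_le _ _).trans ((sum_le_card_nsmul _ _ 1 fun i _ => ?_).trans (by simp))
  compute_degree

/-- The sum `∑ₖ (q^{-n};q)_k (b;q)_k (bq^{k-j};q)_M q^k / ((q;q)_k (bq^{M+1-n};q)_k)`, `j ≤ n ≤ M`. -/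
lemma sum_qBinomCoeff_moment (hq : q ≠ 0) (hq1 : ∀ k : ℤ, k ≠ 0 → q ^ k ≠ 1) {b : ℝ}
    (hb : b ≠ 0) (hbq : ∀ m : ℤ, b * q ^ m ≠ 1) {j n M : ℕ} (hj : j ≤ n) (hn : n ≤ M) :
    ∑ k ∈ range (n + 1), qBinomCoeff q n k * (q ^ k *
        (qPoch q b k * qPoch q (b * q ^ ((k : ℤ) - j)) M / qPoch q (b * q ^ (M + 1 - n)) k)) =
      if j = n then
        qPoch q b (M + 1 - n) * qPoch q (q ^ (-(M : ℤ))) n *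
          ((b * q ^ (M - n)) ^ n * qPoch q q n / qPoch q (b * q ^ (M - n)) (n + 1))
      else 0 := by
  obtain ⟨l, rfl⟩ := Nat.exists_eq_add_of_le hj
  obtain ⟨d, rfl⟩ := Nat.exists_eq_add_of_le hn
  have hd : j + l + d + 1 - (j + l) = d + 1 := by omega
  have hd' : j + l + d - (j + l) = d := by omega
  rw [hd, hd']
  have hc : ∀ i : ℕ, b * q ^ d * q ^ i ≠ 1 := fun i => by
    rw [mul_assoc, ← pow_add, ← zpow_natCast]
    exact hbq _
  have hne : ∀ i k : ℕ, qPoch q (b * q ^ i) k ≠ 0 := fun i k => by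
    simpa using qPoch_mul_zpow_ne_zero hq hbq i k
  set p : ℝ[X] := C (qPoch q b (d + 1)) * (qPochPoly q (b * q ^ (-(j : ℤ))) j *
    qPochPoly q (b * q ^ d) l) with hp
  have hdeg : p.natDegree ≤ j + l :=
    (natDegree_C_mul_le _ _).trans <| natDegree_mul_le.trans <|
      add_le_add (natDegree_qPochPoly_le _ _ _) (natDegree_qPochPoly_le _ _ _)
  have hkey : ∀ k : ℕ, qPoch q b k * qPoch q (b * q ^ ((k : ℤ) - j)) (j + l + d) /
      qPoch q (b * q ^ (d + 1)) k = p.eval (q ^ k) / (1 - b * q ^ d * q ^ k) := fun k => by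
    have e1 : qPoch q (b * q ^ ((k : ℤ) - j)) (j + l + d) =
        qPoch q (b * q ^ (-(j : ℤ)) * q ^ k) j * qPoch q (b * q ^ k) (l + d) := by
      have z1 : q ^ ((k : ℤ) - j) = q ^ (-(j : ℤ)) * q ^ k := by
        rw [← zpow_natCast q k, ← zpow_add₀ hq]
        congr 1
        ring
      have z2 : b * (q ^ (-(j : ℤ)) * q ^ k) * q ^ j = b * q ^ k := by
        rw [zpow_neg, zpow_natCast, mul_assoc, mul_right_comm,
          inv_mul_cancel₀ (pow_ne_zero _ hq), one_mul]
      rw [add_assoc, qPoch_add, z1, z2, mul_assoc b]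
    have e2 : qPoch q b k * qPoch q (b * q ^ k) (l + d) = qPoch q b (d + k + l) := by
      rw [← qPoch_add]
      congr 1
      ring
    have e3 : qPoch q b (d + 1) * qPoch q (b * q ^ (d + 1)) k =
        qPoch q b (d + k) * (1 - b * q ^ d * q ^ k) := by
      rw [← qPoch_add, show d + 1 + k = d + k + 1 by ring, qPoch_succ, pow_add]
      ring
    have e4 := qPoch_add q b (d + k) l
    rw [hp, eval_mul, eval_C, eval_mul, eval_qPochPoly, eval_qPochPoly,
      div_eq_div_iff (hne _ _) (sub_ne_zero.2 (hc k).symm), e1]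
    rw [pow_add, ← mul_assoc b] at e4
    linear_combination (qPoch q (b * q ^ (-(j : ℤ)) * q ^ k) j * (1 - b * q ^ d * q ^ k)) *
      (e2 + e4) - (qPoch q (b * q ^ (-(j : ℤ)) * q ^ k) j * qPoch q (b * q ^ d * q ^ k) l) * e3
  have hc0 : b * q ^ d ≠ 0 := mul_ne_zero hb (pow_ne_zero _ hq)
  simp only [hkey]
  rw [sum_qBinomCoeff_mul_eval_div hq hq1 hdeg hc0 hc, hp, eval_mul, eval_C, eval_mul,
    eval_qPochPoly, eval_qPochPoly, mul_inv_cancel₀ hc0]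
  rcases l with _ | l
  · have z1 : b * q ^ (-(j : ℤ)) * (b * q ^ d)⁻¹ = q ^ (-((j + 0 + d : ℕ) : ℤ)) := by
      simp only [zpow_neg, zpow_natCast, add_zero, pow_add]
      field_simp
    rw [z1, qPoch_zero]
    simp
  · rw [qPoch_succ' q 1, sub_self, zero_mul, mul_zero, mul_zero, zero_mul, if_neg (by omega)]

end QBinomial

section Pastro

variable {q b : ℝ}

lemma sum_pastroW_mul_zpow (hq : q ≠ 0) (hq1 : ∀ k : ℤ, k ≠ 0 → q ^ k ≠ 1) (M : ℕ) (j : ℤ) :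
    ∑ s ∈ range (M + 1), pastroW q b (M + 1) s * (q ^ (s + 1)) ^ j =
      (qPoch q b M)⁻¹ * (q ^ j * qPoch q (b * q ^ j) M) := by
  have h : ∀ s, pastroW q b (M + 1) s * (q ^ (s + 1)) ^ j =
      (qPoch q b M)⁻¹ * q ^ j * (qBinomCoeff q M s * (b * q ^ M * q ^ j) ^ s) := fun s => by
    have e1 : (q ^ (s + 1)) ^ j = q ^ j * (q ^ j) ^ s := by
      rw [pow_succ', mul_zpow, ← zpow_natCast, ← zpow_natCast, zpow_comm]
    have e2 : 1 - ((M + 1 : ℕ) : ℤ) = -(M : ℤ) := by push_cast; ring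
    have e3 : ((M + 1 : ℕ) : ℤ) - 1 = (M : ℤ) := by push_cast; ring
    rw [pastroW, e1, e2, e3, zpow_natCast, qBinomCoeff, Nat.add_sub_cancel]
    ring
  simp only [h]
  rw [← mul_sum, sum_qBinomCoeff_mul_pow hq hq1]
  have e : b * q ^ M * q ^ j * (q ^ M)⁻¹ = b * q ^ j := by
    field_simp
  rw [e]
  ring

lemma sum_pastroW_mul_pastroP (hq : q ≠ 0) (hq1 : ∀ k : ℤ, k ≠ 0 → q ^ k ≠ 1)
    (hb : b ≠ 0) (hbq : ∀ m : ℤ, b * q ^ m ≠ 1) {j n M : ℕ} (hj : j ≤ n) (hn : n ≤ M) :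
    ∑ s ∈ range (M + 1), pastroW q b (M + 1) s *
        (pastroP q (q ^ (-(M : ℤ))) b n (q ^ (s + 1)) * ((q ^ (s + 1)) ^ j)⁻¹) =
      if j = n then
        qPoch q (q ^ (-(M : ℤ))) n * qPoch q q n ^ 2 * (b * q ^ (M - n)) ^ n /
          (q ^ n * qPoch q (q ^ (-(n : ℤ))) n * qPoch q b n * qPoch q (b * q ^ (M - n)) n)
      else 0 := by
  have e1 : (q ^ (-(M : ℤ)))⁻¹ * b * q ^ (1 - (n : ℤ)) = b * q ^ (M + 1 - n) := by
    rw [← zpow_natCast q (M + 1 - n), ← zpow_neg, mul_comm _ b, mul_assoc, ← zpow_add₀ hq]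
    congr 2
    omega
  have hterm : ∀ s, pastroW q b (M + 1) s *
      (pastroP q (q ^ (-(M : ℤ))) b n (q ^ (s + 1)) * ((q ^ (s + 1)) ^ j)⁻¹) =
      ∑ k ∈ range (n + 1), pastroCoeff q (q ^ (-(M : ℤ))) b n k *
        (pastroW q b (M + 1) s * (q ^ (s + 1)) ^ ((k : ℤ) - j)) := fun s => by
    rw [pastroP, sum_mul, mul_sum]
    refine sum_congr rfl fun k _ => ?_
    rw [zpow_sub₀ (pow_ne_zero _ hq), zpow_natCast, zpow_natCast]
    ring
  have hcoeff : ∀ k : ℕ, pastroCoeff q (q ^ (-(M : ℤ))) b n k *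
      ((qPoch q b M)⁻¹ * (q ^ ((k : ℤ) - j) * qPoch q (b * q ^ ((k : ℤ) - j)) M)) =
      (qPoch q (b * q ^ (M + 1 - n)) n * qPoch q q n /
        (qPoch q (q ^ (-(n : ℤ))) n * qPoch q b n) * (qPoch q b M)⁻¹ * (q ^ j)⁻¹) *
      (qBinomCoeff q n k * (q ^ k *
        (qPoch q b k * qPoch q (b * q ^ ((k : ℤ) - j)) M /
          qPoch q (b * q ^ (M + 1 - n)) k))) := fun k => by
    rw [pastroCoeff, e1, qBinomCoeff, zpow_sub₀ hq, zpow_natCast, zpow_natCast]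
    ring
  simp only [hterm]
  rw [sum_comm]
  simp only [← mul_sum, sum_pastroW_mul_zpow hq hq1, hcoeff]
  rw [sum_qBinomCoeff_moment hq hq1 hb hbq hj hn]
  split_ifs with h
  · subst h
    have hne : ∀ i k : ℕ, qPoch q (b * q ^ i) k ≠ 0 := fun i k => by
      simpa using qPoch_mul_zpow_ne_zero hq hbq i k
    have h0 : qPoch q b M ≠ 0 := by simpa using hne 0 M
    have hM : 1 - b * q ^ M ≠ 0 := sub_ne_zero.2 (by simpa using (hbq M).symm)
    have e2 : qPoch q b (M + 1 - j) * qPoch q (b * q ^ (M + 1 - j)) j =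
        qPoch q b M * (1 - b * q ^ M) := by
      rw [← qPoch_add, ← qPoch_succ]
      congr 1
      omega
    have e3 : qPoch q (b * q ^ (M - j)) (j + 1) =
        qPoch q (b * q ^ (M - j)) j * (1 - b * q ^ M) := by
      rw [qPoch_succ, mul_assoc b, ← pow_add, Nat.sub_add_cancel hn]
    rw [e3]
    calc _ = (qPoch q b (M + 1 - j) * qPoch q (b * q ^ (M + 1 - j)) j) *
          (qPoch q b M * (1 - b * q ^ M))⁻¹ * (qPoch q (q ^ (-(M : ℤ))) j * qPoch q q j ^ 2 *
            (b * q ^ (M - j)) ^ j / (q ^ j * qPoch q (q ^ (-(j : ℤ))) j * qPoch q b j *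
              qPoch q (b * q ^ (M - j)) j)) := by
            simp only [div_eq_mul_inv, mul_inv]
            ring
      _ = _ := by rw [e2, mul_inv_cancel₀ (mul_ne_zero h0 hM), one_mul]
  · simp

/-- The coefficient of `x^{-k}` in the partner `R_n(x;a,b;q)`. -/
noncomputable def pastroRCoeff (q a b : ℝ) (n k : ℕ) : ℝ :=
  (qPoch q (q ^ (-(n : ℤ))) n * qPoch q (b * q⁻¹) n /
      (qPoch q (a⁻¹ * b * q ^ (-(n : ℤ))) n * qPoch q q n)) *
    ((qPoch q (q ^ (-(n : ℤ))) k * qPoch q (a * b⁻¹ * q) k /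
      (qPoch q (b⁻¹ * q ^ (2 - (n : ℤ))) k * qPoch q q k)) * (q ^ 2 / a) ^ k)

lemma pastroR_eq_sum (q a b : ℝ) (n : ℕ) (x : ℝ) :
    pastroR q a b n x = ∑ k ∈ range (n + 1), pastroRCoeff q a b n k * (x ^ k)⁻¹ := by
  rw [pastroR, mul_sum]
  refine sum_congr rfl fun k _ => ?_
  rw [pastroRCoeff, ← div_div (q ^ 2), div_pow _ x]
  ring

lemma sum_pastroW_mul_pastroR (hq : q ≠ 0) (hq1 : ∀ k : ℤ, k ≠ 0 → q ^ k ≠ 1)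
    (hb : b ≠ 0) (hbq : ∀ m : ℤ, b * q ^ m ≠ 1) {j m M : ℕ} (hj : j < m) (hm : m ≤ M) :
    ∑ s ∈ range (M + 1), pastroW q b (M + 1) s *
      (pastroR q (q ^ (-(M : ℤ))) b m (q ^ (s + 1)) * (q ^ (s + 1)) ^ j) = 0 := by
  set β : ℝ := b⁻¹ * q ^ (1 - (M : ℤ)) with hβ
  have hβ0 : β ≠ 0 := mul_ne_zero (inv_ne_zero hb) (zpow_ne_zero _ hq)
  have hβq : ∀ i : ℤ, β * q ^ i ≠ 1 := fun i h => by
    refine hbq (-(1 - (M : ℤ) + i)) ?_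
    rw [hβ, mul_assoc, ← zpow_add₀ hq] at h
    rw [inv_mul_eq_one₀ hb] at h
    rw [zpow_neg, ← h, mul_inv_cancel₀ hb]
  have e1 : q ^ (-(M : ℤ)) * b⁻¹ * q = β := by
    rw [hβ, sub_eq_add_neg, add_comm, zpow_add_one₀ hq]
    ring
  have e2 : b⁻¹ * q ^ (2 - (m : ℤ)) = β * q ^ (M + 1 - m) := by
    rw [hβ, mul_assoc, ← zpow_natCast q (M + 1 - m), ← zpow_add₀ hq]
    congr 2
    omega
  have hterm : ∀ s, pastroW q b (M + 1) s *
      (pastroR q (q ^ (-(M : ℤ))) b m (q ^ (s + 1)) * (q ^ (s + 1)) ^ j) =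
      ∑ k ∈ range (m + 1), pastroRCoeff q (q ^ (-(M : ℤ))) b m k *
        (pastroW q b (M + 1) s * (q ^ (s + 1)) ^ ((j : ℤ) - k)) := fun s => by
    rw [pastroR_eq_sum, sum_mul, mul_sum]
    refine sum_congr rfl fun k _ => ?_
    rw [zpow_sub₀ (pow_ne_zero _ hq), zpow_natCast, zpow_natCast]
    ring
  have hrev : ∀ k : ℕ, q ^ ((j : ℤ) - k) * qPoch q (b * q ^ ((j : ℤ) - k)) M *
      (q ^ 2 / q ^ (-(M : ℤ))) ^ k =
      (q ^ j * (-(b * q ^ j)) ^ M * ∏ i ∈ range M, q ^ i) *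
        (q ^ k * qPoch q (β * q ^ ((k : ℤ) - j)) M) := fun k => by
    rw [qPoch_reverse hq (mul_ne_zero hb (zpow_ne_zero _ hq))]
    have z1 : (b * q ^ ((j : ℤ) - k))⁻¹ * q ^ (1 - (M : ℤ)) = β * q ^ ((k : ℤ) - j) := by
      rw [mul_inv, ← zpow_neg, neg_sub, hβ]
      ring
    have z2 : q ^ ((j : ℤ) - k) * (-(b * q ^ ((j : ℤ) - k))) ^ M * (q ^ 2 / q ^ (-(M : ℤ))) ^ k =
        q ^ j * (-(b * q ^ j)) ^ M * q ^ k := by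
      rw [zpow_sub₀ hq, zpow_neg, zpow_natCast, zpow_natCast, zpow_natCast, div_inv_eq_mul,
        ← mul_div_assoc, ← neg_div, div_pow]
      field_simp
      ring
    rw [z1]
    linear_combination ((∏ i ∈ range M, q ^ i) * qPoch q (β * q ^ ((k : ℤ) - j)) M) * z2
  have hcoeff : ∀ k : ℕ, pastroRCoeff q (q ^ (-(M : ℤ))) b m k *
      ((qPoch q b M)⁻¹ * (q ^ ((j : ℤ) - k) * qPoch q (b * q ^ ((j : ℤ) - k)) M)) =
      (qPoch q (q ^ (-(m : ℤ))) m * qPoch q (b * q⁻¹) m /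
        (qPoch q ((q ^ (-(M : ℤ)))⁻¹ * b * q ^ (-(m : ℤ))) m * qPoch q q m) *
        (qPoch q b M)⁻¹ * (q ^ j * (-(b * q ^ j)) ^ M * ∏ i ∈ range M, q ^ i)) *
      (qBinomCoeff q m k * (q ^ k *
        (qPoch q β k * qPoch q (β * q ^ ((k : ℤ) - j)) M /
          qPoch q (β * q ^ (M + 1 - m)) k))) := fun k => by
    rw [pastroRCoeff, e1, e2, qBinomCoeff]
    linear_combination (qPoch q (q ^ (-(m : ℤ))) m * qPoch q (b * q⁻¹) m /
      (qPoch q ((q ^ (-(M : ℤ)))⁻¹ * b * q ^ (-(m : ℤ))) m * qPoch q q m) * (qPoch q b M)⁻¹ *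
      (qPoch q (q ^ (-(m : ℤ))) k * qPoch q β k /
        (qPoch q (β * q ^ (M + 1 - m)) k * qPoch q q k))) * hrev k
  simp only [hterm]
  rw [sum_comm]
  simp only [← mul_sum, sum_pastroW_mul_zpow hq hq1, hcoeff]
  rw [sum_qBinomCoeff_moment hq hq1 hβ0 hβq hj.le hm, if_neg hj.ne, mul_zero]

lemma pastroRCoeff_self_mul (hq : q ≠ 0) (hq1 : ∀ k : ℤ, k ≠ 0 → q ^ k ≠ 1)
    (hb : b ≠ 0) (hbq : ∀ m : ℤ, b * q ^ m ≠ 1) {n M : ℕ} (hn : n ≤ M) :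
    pastroRCoeff q (q ^ (-(M : ℤ))) b n n *
        (qPoch q (q ^ (-(M : ℤ))) n * qPoch q q n ^ 2 * (b * q ^ (M - n)) ^ n /
          (q ^ n * qPoch q (q ^ (-(n : ℤ))) n * qPoch q b n * qPoch q (b * q ^ (M - n)) n)) =
      qPoch q (q ^ (-(M : ℤ))) n * qPoch q q n /
        (qPoch q (q ^ (-(M : ℤ)) * b⁻¹ * q) n * qPoch q b n) := by
  obtain ⟨d, rfl⟩ := Nat.exists_eq_add_of_le hn
  rw [Nat.add_sub_cancel_left, pastroRCoeff]
  set a : ℝ := q ^ (-((n + d : ℕ) : ℤ)) with ha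
  have ha' : a = (q ^ n * q ^ d)⁻¹ := by rw [ha, zpow_neg, zpow_natCast, pow_add]
  have hqn : q ^ n ≠ 0 := pow_ne_zero _ hq
  have hqd : q ^ d ≠ 0 := pow_ne_zero _ hq
  have ha0 : a ≠ 0 := zpow_ne_zero _ hq
  have e1 : a⁻¹ * b * q ^ (-(n : ℤ)) = b * q ^ d := by
    rw [ha', zpow_neg, zpow_natCast]
    field_simp
  have e2 : (b * q⁻¹)⁻¹ * q ^ (1 - (n : ℤ)) = b⁻¹ * q ^ (2 - (n : ℤ)) := by
    rw [mul_inv, inv_inv, mul_assoc, ← zpow_one_add₀ hq]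
    congr 2
    ring
  have e3 : q⁻¹ * q ^ (1 - (n : ℤ)) = q ^ (-(n : ℤ)) := by
    rw [← zpow_neg_one, ← zpow_add₀ hq]
    congr 1
    ring
  have e4 : (a * b⁻¹ * q)⁻¹ * q ^ (1 - (n : ℤ)) = b * q ^ d := by
    rw [ha', zpow_sub₀ hq, zpow_one, zpow_natCast]
    field_simp
  have hU := qPoch_reverse hq hq n
  have hY := qPoch_reverse hq (mul_ne_zero hb (inv_ne_zero hq)) n
  have hZ := qPoch_reverse hq (mul_ne_zero (mul_ne_zero ha0 (inv_ne_zero hb)) hq) n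
  rw [e3] at hU
  rw [e2] at hY
  rw [e4] at hZ
  have hU0 := qPoch_base_ne_zero hq1 n
  have hV0 := right_ne_zero_of_mul (hU ▸ hU0)
  have hD0 := right_ne_zero_of_mul (left_ne_zero_of_mul (hU ▸ hU0))
  have hY0 : qPoch q (b * q⁻¹) n ≠ 0 := by
    simpa using qPoch_mul_zpow_ne_zero hq hbq (-1) n
  have hX0 := right_ne_zero_of_mul (hY ▸ hY0)
  have hC0 : qPoch q (b * q ^ d) n ≠ 0 := by
    simpa using qPoch_mul_zpow_ne_zero hq hbq d n
  have hB0 : qPoch q b n ≠ 0 := by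
    simpa using qPoch_mul_zpow_ne_zero hq hbq 0 n
  have hβ0 : -(a * b⁻¹ * q) ≠ 0 :=
    neg_ne_zero.2 (mul_ne_zero (mul_ne_zero ha0 (inv_ne_zero hb)) hq)
  have hZ0 : qPoch q (a * b⁻¹ * q) n ≠ 0 := by
    rw [hZ]
    exact mul_ne_zero (mul_ne_zero (pow_ne_zero _ hβ0) hD0) hC0
  have hpow : (-(b * q⁻¹)) ^ n * (q ^ 2 / a) ^ n * (b * q ^ d) ^ n *
      ((-(a * b⁻¹ * q)) ^ n * ∏ i ∈ range n, q ^ i) ^ 2 = q ^ n * (-q) ^ n := by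
    refine mul_right_cancel₀ hqn ?_
    have hbase : -(b * q⁻¹) * (q ^ 2 / a) * (b * q ^ d) * (-(a * b⁻¹ * q)) ^ 2 * q ^ n =
        q * (-q) * q := by
      rw [ha']
      field_simp
    calc _ = (-(b * q⁻¹)) ^ n * (q ^ 2 / a) ^ n * (b * q ^ d) ^ n *
          ((-(a * b⁻¹ * q)) ^ 2) ^ n * ((∏ i ∈ range n, q ^ i) ^ 2 * q ^ n) := by
            rw [mul_pow _ _ 2, pow_right_comm]
            ring
      _ = _ := by simp only [prod_pow_sq_mul, ← mul_pow, hbase]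
  rw [e1]
  generalize qPoch q (q ^ (-(n : ℤ))) n = V at *
  generalize qPoch q (b * q ^ d) n = C at *
  generalize qPoch q (a * b⁻¹ * q) n = Z at *
  generalize qPoch q (b⁻¹ * q ^ (2 - (n : ℤ))) n = X at *
  generalize qPoch q (b * q⁻¹) n = Y at *
  generalize qPoch q q n = U at *
  generalize qPoch q a n = A at *
  generalize qPoch q b n = B at *
  generalize ∏ i ∈ range n, q ^ i = D at *
  generalize (q ^ 2 / a) ^ n = E at *
  generalize (b * q ^ d) ^ n = F at *
  generalize (-(a * b⁻¹ * q)) ^ n = G at *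
  generalize (-(b * q⁻¹)) ^ n = H at *
  generalize (-q) ^ n = K at *
  generalize q ^ n = Q at *
  have hmain : Y * V * Z ^ 2 * E * F = X * C ^ 2 * Q * U := by
    rw [hY, hU, hZ]
    linear_combination (D * X * V * C ^ 2) * hpow
  field_simp
  linear_combination A * hmain

end Pastro

end

/-- Discrete biorthogonality of the Pastro polynomials on the real line:
with `a = q^(1-N)` and grid points `x_s = q^(s+1)`,
`∑_s w_s P_n(x_s) R_m(x_s) = h_n δ_{mn}`. -/
theorem pastro_biorthogonality (q b : ℝ) (hq : q ≠ 0) (hq1 : ∀ k : ℤ, k ≠ 0 → q ^ k ≠ 1)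
    (hb : b ≠ 0) (hbq : ∀ m : ℤ, b * q ^ m ≠ 1)
    (N : ℕ) (hN : 0 < N) (m n : ℕ) (hm : m < N) (hn : n < N) :
    ∑ s ∈ Finset.range N,
        pastroW q b N s * pastroP q (q ^ (1 - (N : ℤ))) b n (q ^ (s + 1)) *
          pastroR q (q ^ (1 - (N : ℤ))) b m (q ^ (s + 1)) =
      if m = n then
        qPoch q (q ^ (1 - (N : ℤ))) n * qPoch q q n /
          (qPoch q (q ^ (1 - (N : ℤ)) * b⁻¹ * q) n * qPoch q b n)
      else 0 := by
  obtain ⟨M, rfl⟩ := Nat.exists_eq_succ_of_ne_zero hN.ne'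
  rw [Nat.succ_eq_add_one] at *
  rw [show 1 - ((M + 1 : ℕ) : ℤ) = -(M : ℤ) by push_cast; ring]
  rcases lt_or_ge n m with hnm | hmn
  · rw [if_neg hnm.ne']
    have hterm : ∀ s, pastroW q b (M + 1) s * pastroP q (q ^ (-(M : ℤ))) b n (q ^ (s + 1)) *
        pastroR q (q ^ (-(M : ℤ))) b m (q ^ (s + 1)) =
        ∑ k ∈ Finset.range (n + 1), pastroCoeff q (q ^ (-(M : ℤ))) b n k *
          (pastroW q b (M + 1) s *
            (pastroR q (q ^ (-(M : ℤ))) b m (q ^ (s + 1)) * (q ^ (s + 1)) ^ k)) := fun s => by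
      rw [pastroP, Finset.mul_sum, Finset.sum_mul]
      exact Finset.sum_congr rfl fun k _ => by ring
    simp only [hterm]
    rw [Finset.sum_comm]
    refine Finset.sum_eq_zero fun k hk => ?_
    rw [← Finset.mul_sum, sum_pastroW_mul_pastroR hq hq1 hb hbq
      ((Nat.lt_succ_iff.1 (Finset.mem_range.1 hk)).trans_lt hnm) (Nat.lt_succ_iff.1 hm), mul_zero]
  · have hterm : ∀ s, pastroW q b (M + 1) s * pastroP q (q ^ (-(M : ℤ))) b n (q ^ (s + 1)) *
        pastroR q (q ^ (-(M : ℤ))) b m (q ^ (s + 1)) =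
        ∑ j ∈ Finset.range (m + 1), pastroRCoeff q (q ^ (-(M : ℤ))) b m j *
          (pastroW q b (M + 1) s *
            (pastroP q (q ^ (-(M : ℤ))) b n (q ^ (s + 1)) * ((q ^ (s + 1)) ^ j)⁻¹)) := fun s => by
      rw [pastroR_eq_sum, Finset.mul_sum]
      exact Finset.sum_congr rfl fun k _ => by ring
    have hn' : n ≤ M := Nat.lt_succ_iff.1 hn
    simp only [hterm]
    rw [Finset.sum_comm, Finset.sum_range_succ, ← Finset.mul_sum,
      sum_pastroW_mul_pastroP hq hq1 hb hbq hmn hn', Finset.sum_eq_zero, zero_add]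
    · split_ifs with h
      · subst h
        exact pastroRCoeff_self_mul hq hq1 hb hbq hn'
      · exact mul_zero _
    · intro j hj
      have hjn : j < n := (Finset.mem_range.1 hj).trans_le hmn
      rw [← Finset.mul_sum, sum_pastroW_mul_pastroP hq hq1 hb hbq hjn.le hn', if_neg hjn.ne,
        mul_zero]
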